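/- Let A be a finite set, p a probability mass function on A, m ≥ 1, and X ~ Multinomial(m, p). Fix a subset B ⊆ A and write p_B := ∑_{b ∈ B} p_b. Let U = (U_b)_{b ∈ B} have mutually independent coordinates U_b ~ Poisson(m p_b). Then TV(law((X_b)_{b ∈ B}), law(U)) ≤ m p_B (1 − e^{−p_B}). -/

import Mathlib

open MeasureTheory Filter

/-- Total variation distance `TV(μ,ν) = sup_A |μ(A) - ν(A)|`. -/
noncomputable def tvDist {Ω : Type*} [MeasurableSpace Ω] (μ ν : Measure Ω) : ℝ :=
  ⨆ A : {s : Set Ω // MeasurableSet s}, |(μ A.1).toReal - (ν A.1).toReal|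

/-- Poisson(l) probability mass function on ℕ. -/
noncomputable def poisPMF (l : ℝ) (k : ℕ) : ℝ :=
  Real.exp (-l) * l ^ k / (k.factorial : ℝ)

/-- Multinomial(m,p) pmf on count vectors over a finite alphabet. -/
noncomputable def multinomialPMF {A : Type*} [Fintype A] (m : ℕ) (p : A → ℝ) (h : A → ℕ) : ℝ :=
  if ∑ a, h a = m then (Nat.multinomial Finset.univ h : ℝ) * ∏ a, p a ^ h a else 0

/-- Expectation of `h` under the binomial law. -/
noncomputable def binOp (q : ℝ) (m : ℕ) (h : ℕ → ℝ) : ℝ :=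
  ∑ ij ∈ Finset.HasAntidiagonal.antidiagonal m, (m.choose ij.1 : ℝ) * (q ^ ij.1 * (1 - q) ^ ij.2 * h ij.1)

theorem binOp_succ (q : ℝ) (m : ℕ) (h : ℕ → ℝ) :
    binOp q (m + 1) h = (1 - q) * binOp q m h + q * binOp q m (fun n => h (n + 1)) := by
  unfold binOp
  rw [Finset.sum_antidiagonal_choose_succ_mul (fun i j => q ^ i * (1 - q) ^ j * h i) m,
    Finset.mul_sum, Finset.mul_sum]
  congr 1
  · refine Finset.sum_congr rfl fun x _ => ?_
    rw [pow_succ]; ring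
  · refine Finset.sum_congr rfl fun x hx => ?_
    rw [Finset.HasAntidiagonal.mem_antidiagonal] at hx
    rw [← Nat.choose_symm_of_eq_add hx.symm, pow_succ]; ring

theorem binOp_le (q : NNReal) (hq : q ≤ 1) (m : ℕ) (h : ℕ → ℝ)
    (h0 : ∀ n, 0 ≤ h n) (h1 : ∀ n, h n ≤ 1) :
    binOp q m h - ∫ n, h n ∂(ProbabilityTheory.poissonMeasure (m * q))
      ≤ m * (q * (1 - Real.exp (-q))) := by
  have hint : ∀ (r : NNReal) (g : ℕ → ℝ), (∀ n, 0 ≤ g n) → (∀ n, g n ≤ 1) →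
      Integrable g (ProbabilityTheory.poissonMeasure r) := by
    intro r g g0 g1
    refine Integrable.of_bound (by fun_prop) 1 (Eventually.of_forall fun n => ?_)
    rw [Real.norm_eq_abs, abs_of_nonneg (g0 n)]; exact g1 n
  induction m generalizing h with
  | zero =>
    have : ProbabilityTheory.poissonMeasure 0 = Measure.dirac 0 := by
      refine Measure.ext_of_singleton fun a => ?_
      rw [ProbabilityTheory.poissonMeasure_singleton]
      by_cases ha : a = 0
      · simp [ha]
      · simp [ha, Ne.symm ha]
    simp [binOp, this]
  | succ m ih =>
    set φ : ℕ → ℝ := fun y => ∫ n, h (n + y) ∂(ProbabilityTheory.poissonMeasure (m * q)) with hφ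
    have φ0 : ∀ y, 0 ≤ φ y := fun y => integral_nonneg fun n => h0 _
    have φ1 : ∀ y, φ y ≤ 1 := fun y => by
      have := integral_mono (hint (m * q) (fun n => h (n + y)) (fun n => h0 _) (fun n => h1 _))
        (integrable_const (1 : ℝ)) (fun n => h1 _)
      simpa using this
    have hconv : ∫ n, h n ∂(ProbabilityTheory.poissonMeasure ((m + 1 : ℕ) * q))
        = ∫ y, φ y ∂(ProbabilityTheory.poissonMeasure q) := by
      have e : ((m + 1 : ℕ) : NNReal) * q = q + m * q := by push_cast; ring
      rw [e, ← ProbabilityTheory.poissonMeasure_conv_poissonMeasure, integral_conv]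
      · refine integral_congr_ae (Eventually.of_forall fun y => ?_)
        simp only [hφ, add_comm]
      · rw [ProbabilityTheory.poissonMeasure_conv_poissonMeasure]
        exact hint _ _ h0 h1
    have hlow : Real.exp (-q) * φ 0 + Real.exp (-q) * q * φ 1
        ≤ ∫ y, φ y ∂(ProbabilityTheory.poissonMeasure q) := by
      have := sum_le_hasSum (Finset.range 2) (fun i _ => by
        have := φ0 i
        rw [smul_eq_mul]
        positivity) (ProbabilityTheory.hasSum_integral_poissonMeasure (hint q φ φ0 φ1))
      simpa [Finset.sum_range_succ] using this
    rw [hconv, binOp_succ]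
    have i0 := ih h h0 h1
    have i1 := ih (fun n => h (n + 1)) (fun n => h0 _) (fun n => h1 _)
    have e0 : ∫ n, h n ∂(ProbabilityTheory.poissonMeasure (m * q)) = φ 0 := by simp [hφ]
    have e1 : ∫ n, h (n + 1) ∂(ProbabilityTheory.poissonMeasure (m * q)) = φ 1 := by simp [hφ]
    rw [e0] at i0
    rw [e1] at i1
    have hq0 : (0 : ℝ) ≤ q := q.2
    have hq1 : (q : ℝ) ≤ 1 := by exact_mod_cast hq
    have hexp := Real.add_one_le_exp (-(q : ℝ))
    have hexp1 : Real.exp (-(q : ℝ)) ≤ 1 := Real.exp_le_one_iff.2 (by linarith)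
    have k0 := mul_le_mul_of_nonneg_left i0 (sub_nonneg.2 hq1)
    have k1 := mul_le_mul_of_nonneg_left i1 hq0
    have k2 : (1 - q - Real.exp (-(q : ℝ))) * φ 0 ≤ 0 :=
      mul_nonpos_of_nonpos_of_nonneg (by linarith) (φ0 0)
    have k3 : q * (1 - Real.exp (-(q : ℝ))) * φ 1 ≤ q * (1 - Real.exp (-(q : ℝ))) :=
      mul_le_of_le_one_right (mul_nonneg hq0 (by linarith)) (φ1 1)
    push_cast
    linarith

theorem sum_piAntidiag_div {A : Type*} [DecidableEq A] (s : Finset A) (p : A → ℝ) (n : ℕ) :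
    ∑ k ∈ s.piAntidiag n, ∏ a ∈ s, (p a ^ k a / ((k a).factorial : ℝ))
      = (∑ a ∈ s, p a) ^ n / (n.factorial : ℝ) := by
  rw [Finset.sum_pow_eq_sum_piAntidiag, Finset.sum_div]
  refine Finset.sum_congr rfl fun k hk => ?_
  have hs := Nat.multinomial_spec s k
  rw [(Finset.mem_piAntidiag.1 hk).1] at hs
  rw [← hs, Finset.prod_div_distrib]
  have h1 : (∏ a ∈ s, ((k a).factorial : ℝ)) ≠ 0 :=
    Finset.prod_ne_zero_iff.2 fun a _ => by positivity
  have h2 : ((Nat.multinomial s k : ℕ) : ℝ) ≠ 0 := by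
    intro h0
    have : Nat.multinomial s k = 0 := by exact_mod_cast h0
    exact absurd this (Nat.multinomial_pos s k).ne'
  push_cast
  field_simp

theorem marginal_eq {A : Type*} [Fintype A] [DecidableEq A]
    (p : A → ℝ) (hp1 : ∑ a, p a = 1) (m : ℕ) (B : Finset A) (f : {b // b ∈ B} → ℕ) :
    (∑' g : A → ℕ, if (fun b : {b // b ∈ B} => g b.1) = f then multinomialPMF m p g else 0)
      = (∏ b, (p b.1 ^ f b / ((f b).factorial : ℝ))) *
        (if ∑ b, f b ≤ m then (m.factorial : ℝ) *
          ((1 - ∑ b ∈ B, p b) ^ (m - ∑ b, f b) / ((m - ∑ b, f b).factorial : ℝ)) else 0) := by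
  classical
  set n := ∑ b, f b with hn
  have hcompl : 1 - ∑ b ∈ B, p b = ∑ b ∈ Bᶜ, p b := by
    rw [← hp1, ← Finset.sum_add_sum_compl B p]; ring
  have hsplit : ∀ g : A → ℕ, (fun b : {b // b ∈ B} => g b.1) = f →
      ∑ a, g a = n + ∑ a ∈ Bᶜ, g a := by
    intro g hg
    rw [← Finset.sum_add_sum_compl B g, ← Finset.sum_coe_sort B g, hn, ← hg]
  split_ifs with hle
  · rw [hcompl, ← sum_piAntidiag_div, Finset.mul_sum, Finset.mul_sum]
    set e : (A → ℕ) → (A → ℕ) := fun k a => if h : a ∈ B then f ⟨a, h⟩ else k a with he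
    have einj : Set.InjOn e (Bᶜ.piAntidiag (m - n) : Set (A → ℕ)) := by
      intro k hk l hl hkl
      have hk2 := (Finset.mem_piAntidiag.1 hk).2
      have hl2 := (Finset.mem_piAntidiag.1 hl).2
      funext a
      by_cases ha : a ∈ B
      · have h1 : k a = 0 := by
          by_contra h; exact (Finset.mem_compl.1 (hk2 a h)) ha
        have h2 : l a = 0 := by
          by_contra h; exact (Finset.mem_compl.1 (hl2 a h)) ha
        rw [h1, h2]
      · have := congrFun hkl a
        simpa [he, ha] using this
    have eres : ∀ k, (fun b : {b // b ∈ B} => e k b.1) = f := by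
      intro k; funext b; simp [he]
    rw [tsum_eq_sum (s := (Bᶜ.piAntidiag (m - n)).image e), Finset.sum_image einj]
    · refine Finset.sum_congr rfl fun k hk => ?_
      have hk1 := (Finset.mem_piAntidiag.1 hk).1
      have hc : ∀ a ∈ Bᶜ, e k a = k a := fun a ha => by
        simp [he, Finset.mem_compl.1 ha]
      have hsum : ∑ a, e k a = m := by
        rw [hsplit _ (eres k), Finset.sum_congr rfl hc, hk1]; omega
      rw [if_pos (eres k), multinomialPMF, if_pos hsum]
      have hs := Nat.multinomial_spec Finset.univ (e k)
      rw [hsum] at hs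
      have h1 : (∏ a, ((e k a).factorial : ℝ)) ≠ 0 :=
        Finset.prod_ne_zero_iff.2 fun a _ => by positivity
      have hm : ((Nat.multinomial Finset.univ (e k) : ℕ) : ℝ)
          = m.factorial / ∏ a, ((e k a).factorial : ℝ) := by
        rw [eq_div_iff h1, ← hs]; push_cast; ring
      have hprod : ∏ a, (p a ^ e k a / ((e k a).factorial : ℝ))
          = (∏ b, (p b.1 ^ f b / ((f b).factorial : ℝ))) *
            ∏ a ∈ Bᶜ, (p a ^ k a / ((k a).factorial : ℝ)) := by
        rw [← Finset.prod_mul_prod_compl B, ← Finset.prod_coe_sort B]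
        congr 1
        · refine Finset.prod_congr rfl fun b _ => ?_
          rw [congrFun (eres k) b]
        · refine Finset.prod_congr rfl fun a ha => ?_
          rw [hc a ha]
      rw [hm]
      calc _ = (m.factorial : ℝ) * ∏ a, (p a ^ e k a / ((e k a).factorial : ℝ)) := by
            rw [Finset.prod_div_distrib]; ring
        _ = _ := by rw [hprod]; ring
    · intro g hg
      split_ifs with hgf
      · rw [multinomialPMF, if_neg]
        intro hgs
        apply hg
        rw [hsplit g hgf] at hgs
        refine Finset.mem_image.2 ⟨fun a => if a ∈ B then 0 else g a, ?_, ?_⟩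
        · rw [Finset.mem_piAntidiag]
          constructor
          · rw [Finset.sum_congr rfl (fun a ha => if_neg (Finset.mem_compl.1 ha))]
            exact Nat.eq_sub_of_add_eq' hgs
          · intro a ha
            rw [Finset.mem_compl]
            intro h; simp [h] at ha
        · funext a
          by_cases ha : a ∈ B
          · simp [he, ha, ← hgf]
          · simp [he, ha]
      · rfl
  · rw [mul_zero]
    convert tsum_zero with g
    split_ifs with hgf
    · rw [multinomialPMF, if_neg]
      rw [hsplit g hgf]; omega
    · rfl

theorem measure_le_of_singleton {Ω : Type*} [MeasurableSpace Ω] [Countable Ω]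
    [MeasurableSingletonClass Ω] (μ ν : Measure Ω) (S : Set Ω)
    (h : ∀ x ∈ S, μ {x} ≤ ν {x}) : μ S ≤ ν S := by
  have hS : MeasurableSet S := S.to_countable.measurableSet
  rw [← Measure.tsum_indicator_apply_singleton μ S hS,
    ← Measure.tsum_indicator_apply_singleton ν S hS]
  refine ENNReal.tsum_le_tsum fun x => ?_
  by_cases hx : x ∈ S
  · simpa [hx] using h x hx
  · simp [hx]

/-- Abstract comparison: the positive set `T` maximises the difference. -/
theorem tvDist_le_of_pos {Ω : Type*} [MeasurableSpace Ω] [Countable Ω]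
    [MeasurableSingletonClass Ω] (μ ν : Measure Ω) [IsProbabilityMeasure μ]
    [IsProbabilityMeasure ν] (T : Set Ω) (c : ℝ)
    (h1 : ∀ x ∈ T, ν {x} ≤ μ {x}) (h2 : ∀ x ∉ T, μ {x} ≤ ν {x})
    (hc : μ.real T - ν.real T ≤ c) : tvDist μ ν ≤ c := by
  have hm : ∀ S : Set Ω, MeasurableSet S := fun S => S.to_countable.measurableSet
  have key : ∀ S : Set Ω, μ.real S - ν.real S ≤ c := by
    intro S
    have a1 := measureReal_inter_add_sdiff (μ := μ) (s := S) (hm T)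
    have a2 := measureReal_inter_add_sdiff (μ := ν) (s := S) (hm T)
    have b1 := measureReal_inter_add_sdiff (μ := μ) (s := T) (hm S)
    have b2 := measureReal_inter_add_sdiff (μ := ν) (s := T) (hm S)
    rw [Set.inter_comm] at b1 b2
    have c1 : μ.real (S \ T) ≤ ν.real (S \ T) :=
      ENNReal.toReal_mono (measure_ne_top _ _)
        (measure_le_of_singleton _ _ _ fun x hx => h2 x hx.2)
    have c2 : ν.real (T \ S) ≤ μ.real (T \ S) :=
      ENNReal.toReal_mono (measure_ne_top _ _)
        (measure_le_of_singleton _ _ _ fun x hx => h1 x hx.1)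
    linarith
  unfold tvDist
  have : Nonempty {s : Set Ω // MeasurableSet s} := ⟨⟨∅, hm _⟩⟩
  refine ciSup_le fun S => ?_
  change |μ.real S.1 - ν.real S.1| ≤ c
  rw [abs_le]
  refine ⟨?_, key _⟩
  have := key S.1ᶜ
  rw [probReal_compl_eq_one_sub S.2, probReal_compl_eq_one_sub S.2] at this
  linarith

/-- Multinomial-to-independent-Poissons bound on rare categories: if `X ~ Mult(m,p)` and
`U` has independent coordinates `U_b ~ Poi(m p_b)` for `b ∈ B`, then
`TV(law((X_b)_{b∈B}), law(U)) ≤ m p_B (1 - e^{-p_B})`, where `p_B = ∑_{b∈B} p_b`. -/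
theorem stmt19 {A : Type*} [Fintype A] [DecidableEq A]
    (p : A → ℝ) (hp0 : ∀ a, 0 ≤ p a) (hp1 : ∑ a, p a = 1)
    (m : ℕ) (hm : 1 ≤ m) (B : Finset A)
    (μ ν : Measure ({b // b ∈ B} → ℕ))
    [IsProbabilityMeasure μ] [IsProbabilityMeasure ν]
    (hμ : ∀ f : {b // b ∈ B} → ℕ, μ {f} = ENNReal.ofReal
      (∑' g : A → ℕ, if (fun b : {b // b ∈ B} => g b.1) = f then multinomialPMF m p g else 0))
    (hν : ∀ f : {b // b ∈ B} → ℕ, ν {f} = ENNReal.ofReal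
      (∏ b : {b // b ∈ B}, poisPMF ((m : ℝ) * p b.1) (f b))) :
    tvDist μ ν ≤ (m : ℝ) * (∑ b ∈ B, p b) * (1 - Real.exp (-(∑ b ∈ B, p b))) := by
  classical
  set q : ℝ := ∑ b ∈ B, p b with hq
  have hq0 : 0 ≤ q := Finset.sum_nonneg fun a _ => hp0 a
  have hq1 : q ≤ 1 := by
    rw [← hp1]
    exact Finset.sum_le_sum_of_subset_of_nonneg (Finset.subset_univ B) fun a _ _ => hp0 a
  set c : ({b // b ∈ B} → ℕ) → ℝ := fun f => ∏ b, (p b.1 ^ f b / ((f b).factorial : ℝ)) with hc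
  have hc0 : ∀ f, 0 ≤ c f := fun f => Finset.prod_nonneg fun b _ => by
    have := hp0 b.1
    positivity
  set α : ℕ → ℝ := fun n => if n ≤ m then (m.factorial : ℝ) *
          ((1 - q) ^ (m - n) / ((m - n).factorial : ℝ)) else 0 with hα
  set β : ℕ → ℝ := fun n => Real.exp (-(m * q)) * (m : ℝ) ^ n with hβ
  have hα0 : ∀ n, 0 ≤ α n := fun n => by
    have : 0 ≤ 1 - q := by linarith
    simp only [hα]
    split_ifs
    · positivity
    · exact le_rfl
  have hβ0 : ∀ n, 0 ≤ β n := fun n => by positivity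
  have hμ' : ∀ f, μ {f} = ENNReal.ofReal (c f * α (∑ b, f b)) := by
    intro f
    rw [hμ f, marginal_eq p hp1 m B f]
  have hν' : ∀ f, ν {f} = ENNReal.ofReal (c f * β (∑ b, f b)) := by
    intro f
    rw [hν f]
    congr 1
    simp only [hc, hβ, poisPMF, hq]
    rw [← Finset.sum_coe_sort B p, Finset.mul_sum, ← Finset.sum_neg_distrib, Real.exp_sum,
      ← Finset.prod_pow_eq_pow_sum, ← Finset.prod_mul_distrib, ← Finset.prod_mul_distrib]
    refine Finset.prod_congr rfl fun b _ => ?_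
    rw [mul_pow]; ring
  set tot : ({b // b ∈ B} → ℕ) → ℕ := fun f => ∑ b, f b with htot
  have htm : Measurable tot := by fun_prop
  have hmap : ∀ (ρ : Measure ({b // b ∈ B} → ℕ)) (γ : ℕ → ℝ), (∀ n, 0 ≤ γ n) →
      (∀ f, ρ {f} = ENNReal.ofReal (c f * γ (∑ b, f b))) →
      ∀ n, ρ.map tot {n} = ENNReal.ofReal (q ^ n / (n.factorial : ℝ) * γ n) := by
    intro ρ γ γ0 h n
    rw [Measure.map_apply htm (measurableSet_singleton n)]
    have hset : tot ⁻¹' {n} = ((Finset.univ.piAntidiag n : Finset ({b // b ∈ B} → ℕ)) :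
        Set ({b // b ∈ B} → ℕ)) := by
      ext f; simp [htot]
    rw [hset, ← sum_measure_singleton, Finset.sum_congr rfl (fun f _ => h f),
      ← ENNReal.ofReal_sum_of_nonneg (fun f _ => mul_nonneg (hc0 f) (γ0 _))]
    congr 1
    rw [hq, ← Finset.sum_coe_sort B p,
      ← sum_piAntidiag_div Finset.univ (fun b : {b // b ∈ B} => p b.1) n, Finset.sum_mul]
    refine Finset.sum_congr rfl fun f hf => ?_
    rw [(Finset.mem_piAntidiag.1 hf).1]
  have hmapμ := hmap μ α hα0 hμ'
  have hmapν := hmap ν β hβ0 hν'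
  set Q : NNReal := ⟨q, hq0⟩ with hQ
  have hνP : ν.map tot = ProbabilityTheory.poissonMeasure (m * Q) := by
    refine Measure.ext_of_singleton fun n => ?_
    rw [hmapν, ProbabilityTheory.poissonMeasure_singleton]
    congr 1
    have : ((m * Q : NNReal) : ℝ) = m * q := by
      rw [NNReal.coe_mul, NNReal.coe_natCast]; rfl
    rw [this, mul_pow]
    simp only [hβ]; ring
  set T : Set ℕ := {n | β n ≤ α n} with hT
  refine tvDist_le_of_pos μ ν (tot ⁻¹' T) _ ?_ ?_ ?_
  · intro f hf
    rw [hμ', hν']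
    exact ENNReal.ofReal_le_ofReal (mul_le_mul_of_nonneg_left hf (hc0 f))
  · intro f hf
    rw [hμ', hν']
    refine ENNReal.ofReal_le_ofReal (mul_le_mul_of_nonneg_left ?_ (hc0 f))
    exact (not_le.1 hf).le
  · have hTm : MeasurableSet T := T.to_countable.measurableSet
    have hb := binOp_le Q (by exact_mod_cast hq1) m (T.indicator fun _ => (1 : ℝ))
      (fun n => Set.indicator_nonneg (fun _ _ => zero_le_one) n)
      (fun n => Set.indicator_le_self' (fun _ _ => zero_le_one) n)
    rw [integral_indicator_const _ hTm, ← hνP] at hb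
    have hνT : (ν.map tot).real T = ν.real (tot ⁻¹' T) := by
      rw [measureReal_def, measureReal_def, Measure.map_apply htm hTm]
    have hμT : μ.real (tot ⁻¹' T) = binOp q m (T.indicator fun _ => (1 : ℝ)) := by
      have hnn : ∀ n, 0 ≤ q ^ n / (n.factorial : ℝ) * α n := fun n =>
        mul_nonneg (by positivity) (hα0 n)
      have e1 : μ (tot ⁻¹' T) = ∑ n ∈ Finset.range (m + 1),
          T.indicator (fun n => ENNReal.ofReal (q ^ n / (n.factorial : ℝ) * α n)) n := by
        rw [← Measure.map_apply htm hTm, ← Measure.tsum_indicator_apply_singleton _ T hTm]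
        simp_rw [hmapμ]
        refine tsum_eq_sum fun n hn => ?_
        have hn' : ¬ n ≤ m := by simpa [Nat.lt_succ_iff] using hn
        simp [hα, hn']
      rw [measureReal_def, e1, ENNReal.toReal_sum, binOp,
        Finset.Nat.sum_antidiagonal_eq_sum_range_succ_mk]
      · refine Finset.sum_congr rfl fun n hn => ?_
        have hn' : n ≤ m := by simpa [Nat.lt_succ_iff] using hn
        by_cases hnT : n ∈ T
        · simp only [Set.indicator_of_mem hnT]
          rw [ENNReal.toReal_ofReal (hnn n), Nat.cast_choose ℝ hn']
          simp only [hα, if_pos hn']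
          field_simp
        · simp [hnT]
      · intro n _
        by_cases hnT : n ∈ T <;> simp [hnT]
    rw [hμT, ← hνT]
    have : (Q : ℝ) = q := rfl
    rw [this] at hb
    simp only [smul_eq_mul, mul_one] at hb
    linarith
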